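/- Let A_1,…,A_N with A_i ∈ ℝ^{n×n}, let Â = blockdiag{I_{p_1}⊗A_1,…,I_{p_N}⊗A_N} with p_i ≥ 1, let c > 0 and c_i > 0, and let L̂_c be the block lower triangular matrix with diagonal blocks c_i L̂_{ii} ∈ ℝ^{p_i×p_i}, blocks L̂_{ij} for j < i, and zero blocks for j > i. Then the set of complex eigenvalues of Â − c L̂_c ⊗ I_n equals ∪_{i=1}^N { α − c·c_i·β : α an eigenvalue of A_i over ℂ, β an eigenvalue of L̂_{ii} over ℂ }. Consequently, Â − c L̂_c ⊗ I_n is Hurwitz if and only if for every i, c·c_i·min{Re β : β ∈ σ(L̂_{ii})} > max{Re α : α ∈ σ(A_i)}. -/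

import Mathlib

open Matrix

/-- A real square matrix is Hurwitz if every complex eigenvalue has negative real part. -/
noncomputable def IsHurwitz {m : Type*} [Fintype m] [DecidableEq m] (M : Matrix m m ℝ) : Prop :=
  ∀ μ ∈ spectrum ℂ (M.map Complex.ofReal), μ.re < 0

/-- `Â = blockdiag {I_{p_1} ⊗ A_1, …, I_{p_N} ⊗ A_N}`. -/
noncomputable def hatA (n N : ℕ) (p : Fin N → ℕ) (A : Fin N → Matrix (Fin n) (Fin n) ℝ) :
    Matrix (((i : Fin N) × Fin (p i)) × Fin n) (((i : Fin N) × Fin (p i)) × Fin n) ℝ :=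
  Matrix.of fun u v => if u.1 = v.1 then A u.1.1 u.2 v.2 else 0

/-- Every eigenvalue of the difference of two commuting endomorphisms is a difference of eigenvalues. -/
theorem Module.End.exists_sub_eq_of_mem_spectrum_sub {K V : Type*} [Field K] [IsAlgClosed K]
    [AddCommGroup V] [Module K V] [FiniteDimensional K V] {f g : Module.End K V}
    (h : Commute f g) {z : K} (hz : z ∈ spectrum K (f - g)) :
    ∃ α ∈ spectrum K f, ∃ β ∈ spectrum K g, z = α - β := by
  rw [← Module.End.hasEigenvalue_iff_mem_spectrum] at hz
  have hmaps : ∀ x ∈ (f - g).eigenspace z, f x ∈ (f - g).eigenspace z := fun x hx =>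
    Module.End.mapsTo_genEigenspace_of_comm ((Commute.refl f).sub_left h.symm) z 1 hx
  have : Nontrivial ((f - g).eigenspace z) := Submodule.nontrivial_iff_ne_bot.2 hz
  obtain ⟨α, hα⟩ := Module.End.exists_eigenvalue (f.restrict hmaps)
  obtain ⟨⟨x, hx⟩, hxα⟩ := hα.exists_hasEigenvector
  have hx0 : x ≠ 0 := fun h0 => hxα.2 (Subtype.ext h0)
  have hfx : f x = α • x := congrArg Subtype.val hxα.apply_eq_smul
  have hgx : g x = (α - z) • x := by
    have := Module.End.mem_eigenspace_iff.1 hx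
    rw [LinearMap.sub_apply, hfx] at this
    rw [sub_smul, ← this]; abel
  exact ⟨α, (Module.End.hasEigenvalue_of_hasEigenvector
      ⟨Module.End.mem_eigenspace_iff.2 hfx, hx0⟩).mem_spectrum, α - z,
    (Module.End.hasEigenvalue_of_hasEigenvector
      ⟨Module.End.mem_eigenspace_iff.2 hgx, hx0⟩).mem_spectrum, by ring⟩

open Kronecker in
/-- The spectrum of the Kronecker difference `1 ⊗ A - B ⊗ 1` is `σ(A) - σ(B)`. -/
theorem Matrix.spectrum_one_kronecker_sub_kronecker_one {K m n : Type*} [Field K] [IsAlgClosed K]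
    [Fintype m] [DecidableEq m] [Fintype n] [DecidableEq n]
    (A : Matrix n n K) (B : Matrix m m K) :
    spectrum K ((1 : Matrix m m K) ⊗ₖ A - B ⊗ₖ (1 : Matrix n n K)) =
      {z | ∃ α ∈ spectrum K A, ∃ β ∈ spectrum K B, z = α - β} := by
  ext z
  constructor
  · intro hz
    have hcomm : Commute (toLin' ((1 : Matrix m m K) ⊗ₖ A)) (toLin' (B ⊗ₖ (1 : Matrix n n K))) := by
      simp only [Commute, SemiconjBy, Module.End.mul_eq_comp, ← toLin'_mul, ← mul_kronecker_mul,
        one_mul, mul_one]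
    rw [← spectrum_toLin', map_sub] at hz
    obtain ⟨α, hα, β, hβ, rfl⟩ := Module.End.exists_sub_eq_of_mem_spectrum_sub hcomm hz
    rw [spectrum_toLin'] at hα hβ
    refine ⟨α, ?_, β, ?_, rfl⟩
    · contrapose! hα
      rw [spectrum.notMem_iff, Matrix.isUnit_iff_isUnit_det] at hα ⊢
      have : algebraMap K (Matrix (m × n) (m × n) K) α - 1 ⊗ₖ A
          = (1 : Matrix m m K) ⊗ₖ (algebraMap K (Matrix n n K) α - A) := by
        rw [sub_eq_iff_eq_add, ← kronecker_add, sub_add_cancel]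
        simp [Algebra.algebraMap_eq_smul_one, kronecker_smul]
      rw [this, det_kronecker]
      exact (by simp : IsUnit (det (1 : Matrix m m K) ^ Fintype.card n)).mul (hα.pow _)
    · contrapose! hβ
      rw [spectrum.notMem_iff, Matrix.isUnit_iff_isUnit_det] at hβ ⊢
      have : algebraMap K (Matrix (m × n) (m × n) K) β - B ⊗ₖ 1
          = (algebraMap K (Matrix m m K) β - B) ⊗ₖ (1 : Matrix n n K) := by
        rw [sub_eq_iff_eq_add, ← add_kronecker, sub_add_cancel]
        simp [Algebra.algebraMap_eq_smul_one, smul_kronecker]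
      rw [this, det_kronecker]
      exact (hβ.pow _).mul (by simp)
  · rintro ⟨α, hα, β, hβ, rfl⟩
    rw [← spectrum_toLin', ← Module.End.hasEigenvalue_iff_mem_spectrum] at hα hβ ⊢
    obtain ⟨x, hx⟩ := hα.exists_hasEigenvector
    obtain ⟨y, hy⟩ := hβ.exists_hasEigenvector
    have hAx := hx.apply_eq_smul
    have hBy := hy.apply_eq_smul
    rw [toLin'_apply] at hAx hBy
    refine Module.End.hasEigenvalue_of_hasEigenvector (x := fun u : m × n => y u.1 * x u.2)
      ⟨Module.End.mem_eigenspace_iff.2 ?_, fun h0 => ?_⟩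
    · ext ⟨a, k⟩
      have h1 := congrFun hAx k
      have h2 := congrFun hBy a
      simp only [mulVec, dotProduct, Pi.smul_apply, smul_eq_mul] at h1 h2
      simp only [toLin'_apply, mulVec, dotProduct, Pi.smul_apply, smul_eq_mul, sub_apply,
        kroneckerMap_apply, one_apply, Fintype.sum_prod_type, sub_mul, Finset.sum_sub_distrib,
        ite_mul, mul_ite, zero_mul, mul_zero, one_mul, mul_one, Finset.sum_ite_eq, Finset.mem_univ,
        if_true, Finset.sum_ite_irrel, Finset.sum_const_zero]
      have e1 : ∑ j, A k j * (y a * x j) = y a * ∑ j, A k j * x j := by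
        rw [Finset.mul_sum]; exact Finset.sum_congr rfl fun _ _ => by ring
      have e2 : ∑ j, B a j * (y j * x k) = (∑ j, B a j * y j) * x k := by
        rw [Finset.sum_mul]; exact Finset.sum_congr rfl fun _ _ => by ring
      rw [e1, e2, h1, h2]; ring
    · obtain ⟨k, hk⟩ := Function.ne_iff.1 hx.2
      obtain ⟨a, ha⟩ := Function.ne_iff.1 hy.2
      exact mul_ne_zero ha hk (congrFun h0 (a, k))

/-- The spectrum of a block lower triangular matrix, with blocks indexed by `i` and each block
indexed by `m i × n`, is the union of the spectra of its diagonal blocks. -/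
theorem Matrix.spectrum_eq_iUnion_of_block_lower_triangular {K ι n : Type*} [Field K] [Fintype ι]
    [LinearOrder ι] [Fintype n] [DecidableEq n] {m : ι → Type*} [∀ i, Fintype (m i)]
    [∀ i, DecidableEq (m i)] (M : Matrix (((i : ι) × m i) × n) (((i : ι) × m i) × n) K)
    (hM : ∀ u v, u.1.1 < v.1.1 → M u v = 0) :
    spectrum K M = ⋃ i, spectrum K (M.submatrix
      (fun a : m i × n => ((⟨i, a.1⟩ : (i : ι) × m i), a.2)) fun a : m i × n => (⟨i, a.1⟩, a.2)) := by
  let b : ((i : ι) × m i) × n → ιᵒᵈ := fun u => OrderDual.toDual u.1.1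
  have hb : M.BlockTriangular b := fun u v h => hM u v h
  have hchar : M.charpoly = ∏ i : ι, (M.submatrix
      (fun a : m i × n => ((⟨i, a.1⟩ : (i : ι) × m i), a.2)) fun a => (⟨i, a.1⟩, a.2)).charpoly := by
    rw [Matrix.charpoly, hb.charmatrix.det_fintype, ← OrderDual.toDual.prod_comp]
    refine Finset.prod_congr rfl fun i _ => ?_
    rw [← charmatrix_toSquareBlock, ← Matrix.charpoly]
    let e : m i × n ≃ {u // b u = OrderDual.toDual i} :=
      Equiv.ofBijective (fun a => ⟨((⟨i, a.1⟩ : (i : ι) × m i), a.2), rfl⟩) <| by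
        constructor
        · rintro ⟨a, k⟩ ⟨a', k'⟩ h
          simpa using h
        · rintro ⟨⟨⟨j, a⟩, k⟩, hj⟩
          obtain rfl : j = i := hj
          exact ⟨(a, k), rfl⟩
    rw [← charpoly_reindex e.symm]
    rfl
  ext z
  simp only [Set.mem_iUnion, mem_spectrum_iff_isRoot_charpoly, hchar, Polynomial.isRoot_prod,
    Finset.mem_univ, true_and]

theorem Complex.forall_re_sub_neg_iff_sSup_lt_sInf {S T : Set ℂ} (hS : S.Finite)
    (hS' : S.Nonempty) (hT : T.Finite) (hT' : T.Nonempty) {t : ℝ} (ht : 0 < t) :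
    (∀ α ∈ S, ∀ β ∈ T, (α - t * β).re < 0) ↔
      sSup (Complex.re '' S) < t * sInf (Complex.re '' T) := by
  constructor
  · intro h
    obtain ⟨α, hα, hα'⟩ := (hS'.image Complex.re).csSup_mem (hS.image _)
    obtain ⟨β, hβ, hβ'⟩ := (hT'.image Complex.re).csInf_mem (hT.image _)
    have := h α hα β hβ
    rw [← hα', ← hβ']
    simpa using this
  · intro h α hα β hβ
    have h1 := le_csSup (hS.image Complex.re).bddAbove (Set.mem_image_of_mem _ hα)
    have h2 := csInf_le (hT.image Complex.re).bddBelow (Set.mem_image_of_mem _ hβ)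
    have h3 := mul_le_mul_of_nonneg_left h2 ht.le
    rw [Complex.sub_re, Complex.re_ofReal_mul]
    linarith

theorem Matrix.spectrum_smul_of_ne_zero {K m : Type*} [Field K] [Fintype m] [DecidableEq m]
    (B : Matrix m m K) {t : K} (ht : t ≠ 0) :
    spectrum K (t • B) = (fun β => t * β) '' spectrum K B := by
  have := spectrum.unit_smul_eq_smul B (Units.mk0 t ht)
  rwa [Units.smul_mk0] at this

/-- For a block lower triangular `L̂_c` with diagonal blocks `c_i L̂_{ii}`, the spectrum of
`Â - c L̂_c ⊗ I_n` is the union over `i` of the sets `{α - c c_i β}` with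
`α ∈ σ(A_i)`, `β ∈ σ(L̂_{ii})`; consequently `Â - c L̂_c ⊗ I_n` is Hurwitz iff
`c c_i min Re σ(L̂_{ii}) > max Re σ(A_i)` for every `i`. -/
theorem spectrum_block_triangular_and_isHurwitz_iff
    (n N : ℕ) (hn : 0 < n) (p : Fin N → ℕ) (hp : ∀ i, 1 ≤ p i)
    (A : Fin N → Matrix (Fin n) (Fin n) ℝ)
    (c : ℝ) (hc : 0 < c) (ci : Fin N → ℝ) (hci : ∀ i, 0 < ci i)
    (Lhat : Matrix ((i : Fin N) × Fin (p i)) ((i : Fin N) × Fin (p i)) ℝ)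
    (htri : ∀ u v : (i : Fin N) × Fin (p i), u.1 < v.1 → Lhat u v = 0) :
    (spectrum ℂ
        ((hatA n N p A -
            c • Matrix.kroneckerMap (· * ·)
              (Matrix.of fun u v : (i : Fin N) × Fin (p i) =>
                (if u.1 = v.1 then ci u.1 else 1) * Lhat u v)
              (1 : Matrix (Fin n) (Fin n) ℝ)).map Complex.ofReal)
      = ⋃ i : Fin N, {z : ℂ |
          ∃ α ∈ spectrum ℂ ((A i).map Complex.ofReal),
          ∃ β ∈ spectrum ℂ ((Matrix.of fun a b : Fin (p i) =>
              Lhat ⟨i, a⟩ ⟨i, b⟩).map Complex.ofReal),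
            z = α - (((c * ci i : ℝ) : ℂ)) * β})
    ∧ (IsHurwitz
        (hatA n N p A -
          c • Matrix.kroneckerMap (· * ·)
            (Matrix.of fun u v : (i : Fin N) × Fin (p i) =>
              (if u.1 = v.1 then ci u.1 else 1) * Lhat u v)
            (1 : Matrix (Fin n) (Fin n) ℝ)) ↔
      ∀ i : Fin N,
        sSup (Complex.re '' spectrum ℂ ((A i).map Complex.ofReal)) <
          c * ci i *
            sInf (Complex.re '' spectrum ℂ ((Matrix.of fun a b : Fin (p i) =>
              Lhat ⟨i, a⟩ ⟨i, b⟩).map Complex.ofReal))) := by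
  have hspec : spectrum ℂ
        ((hatA n N p A -
            c • Matrix.kroneckerMap (· * ·)
              (Matrix.of fun u v : (i : Fin N) × Fin (p i) =>
                (if u.1 = v.1 then ci u.1 else 1) * Lhat u v)
              (1 : Matrix (Fin n) (Fin n) ℝ)).map Complex.ofReal)
      = ⋃ i : Fin N, {z : ℂ |
          ∃ α ∈ spectrum ℂ ((A i).map Complex.ofReal),
          ∃ β ∈ spectrum ℂ ((Matrix.of fun a b : Fin (p i) =>
              Lhat ⟨i, a⟩ ⟨i, b⟩).map Complex.ofReal),
            z = α - (((c * ci i : ℝ) : ℂ)) * β} := by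
    rw [Matrix.spectrum_eq_iUnion_of_block_lower_triangular]
    · refine Set.iUnion_congr fun i => ?_
      have ht : ((c * ci i : ℝ) : ℂ) ≠ 0 := by exact_mod_cast (mul_pos hc (hci i)).ne'
      have hblock := Matrix.spectrum_one_kronecker_sub_kronecker_one ((A i).map Complex.ofReal)
        (((c * ci i : ℝ) : ℂ) • (Matrix.of fun a b : Fin (p i) =>
              Lhat ⟨i, a⟩ ⟨i, b⟩).map Complex.ofReal)
      simp only [Matrix.spectrum_smul_of_ne_zero _ ht, Set.exists_mem_image] at hblock
      rw [← hblock]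
      congr 1
      ext ⟨a, k⟩ ⟨b, l⟩
      by_cases hab : a = b <;> by_cases hkl : k = l <;>
        simp [hatA, hab, hkl, mul_assoc]
    · intro u v huv
      have h1 : u.1 ≠ v.1 := fun h => huv.ne (congrArg Sigma.fst h)
      simp [hatA, h1, htri _ _ huv]
  refine ⟨hspec, ?_⟩
  rw [IsHurwitz, hspec]
  have : Nonempty (Fin n) := ⟨⟨0, hn⟩⟩
  have hne (i : Fin N) : Nonempty (Fin (p i)) := ⟨⟨0, hp i⟩⟩
  have hiff (i : Fin N) := Complex.forall_re_sub_neg_iff_sSup_lt_sInf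
    (Matrix.finite_spectrum ((A i).map Complex.ofReal))
    (spectrum.nonempty_of_isAlgClosed_of_finiteDimensional ℂ _)
    (Matrix.finite_spectrum ((Matrix.of fun a b : Fin (p i) =>
              Lhat ⟨i, a⟩ ⟨i, b⟩).map Complex.ofReal))
    (spectrum.nonempty_of_isAlgClosed_of_finiteDimensional ℂ _) (mul_pos hc (hci i))
  simp only [← hiff, Set.mem_iUnion, Set.mem_ofPred_eq]
  constructor
  · exact fun h i α hα β hβ => h _ ⟨i, α, hα, β, hβ, rfl⟩
  · rintro h _ ⟨i, α, hα, β, hβ, rfl⟩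
    exact h i α hα β hβ
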